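/- Let N be odd, let 2 ≤ K ≤ N−3 with N·K even, and let A_K be the adjacency matrix of a simple undirected K-regular graph on N vertices. Then there exist a simple undirected (K+2)-regular graph on N vertices with adjacency matrix A_{K+2} and N×N permutation matrices P₃, P₄ and P₅ such that A_{K+2} = P₃·(A_K + P₄ + P₅). -/

import Mathlib

open Matrix

attribute [local instance] Classical.propDecidable

/-- A 0/1 square matrix with exactly one 1 in each row and each column. -/
def IsPermMatrix {n : ℕ} (P : Matrix (Fin n) (Fin n) ℝ) : Prop :=
  (∀ i j, P i j = 0 ∨ P i j = 1) ∧ (∀ i, ∑ j, P i j = 1) ∧ (∀ j, ∑ i, P i j = 1)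

lemma hall_aux {α β : Type*} [Fintype α] [Fintype β] (r : α → β → Prop) (d : ℕ) (hd : 0 < d)
    (h1 : ∀ a, d ≤ (Finset.univ.filter (fun b => r a b)).card)
    (h2 : ∀ b, (Finset.univ.filter (fun a => r a b)).card ≤ d) :
    ∃ f : α → β, Function.Injective f ∧ ∀ a, r a (f a) := by
  refine (Fintype.all_card_le_filter_rel_iff_exists_injective r).1 ?_
  intro A
  set B := Finset.univ.filter (fun b => ∃ a ∈ A, r a b) with hB
  have := Finset.card_mul_le_card_mul (s := A) (t := B) r (m := d) (n := d) ?_ ?_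
  · exact Nat.le_of_mul_le_mul_right this hd
  · intro a ha
    refine (h1 a).trans (Finset.card_le_card ?_)
    intro b hb
    simp only [Finset.mem_filter, Finset.mem_univ, true_and] at hb
    simp only [Finset.bipartiteAbove, Finset.mem_filter, hB, Finset.mem_univ, true_and]
    exact ⟨⟨a, ha, hb⟩, hb⟩
  · intro b _
    refine le_trans (Finset.card_le_card ?_) (h2 b)
    intro a ha
    simp only [Finset.bipartiteBelow, Finset.mem_filter] at ha
    simp [ha.2]

lemma orient_aux {n : ℕ} (H : SimpleGraph (Fin n)) (m : ℕ) (hm : 0 < m)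
    (hreg : ∀ v, (Finset.univ.filter (fun w => H.Adj v w)).card = 2 * m) :
    ∃ D : Fin n → Fin n → Prop, (∀ v w, D v w → H.Adj v w) ∧ (∀ v w, D v w → ¬ D w v) ∧
      (∀ v, m ≤ (Finset.univ.filter (fun w => D v w)).card) ∧
      (∀ w, (Finset.univ.filter (fun v => D v w)).card ≤ m) := by
  obtain ⟨f, finj, hf⟩ := hall_aux (α := Fin n × Fin m) (β := Sym2 (Fin n))
    (fun p e => ∃ w, H.Adj p.1 w ∧ e = s(p.1, w)) (2 * m) (by omega)
    (by
      rintro ⟨v, i⟩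
      rw [← hreg v]
      refine Finset.card_le_card_of_injOn (fun w => s(v, w)) ?_ ?_
      · intro w hw
        simp only [Finset.coe_filter, Finset.mem_univ, true_and, Set.mem_ofPred_eq] at hw ⊢
        exact ⟨w, hw, rfl⟩
      · intro a _ b _ hab
        exact Sym2.congr_right.1 hab)
    (by
      intro e
      induction e using Sym2.ind with
      | _ x y =>
        refine le_trans (Finset.card_le_card
          (t := ({x, y} : Finset (Fin n)) ×ˢ (Finset.univ : Finset (Fin m))) ?_) ?_
        · rintro ⟨v, i⟩ hv
          simp only [Finset.mem_filter, Finset.mem_univ, true_and] at hv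
          obtain ⟨w, _, h⟩ := hv
          rw [Sym2.eq_iff] at h
          simp only [Finset.mem_product, Finset.mem_insert, Finset.mem_singleton, Finset.mem_univ]
          rcases h with h | h <;> simp [h.1, h.2]
        · rw [Finset.card_product, Finset.card_univ, Fintype.card_fin]
          exact Nat.mul_le_mul_right m Finset.card_le_two)
  choose g hg1 hg2 using hf
  have hasymm : ∀ v w, (∃ i, g (v, i) = w) → ¬ (∃ i, g (w, i) = v) := by
    rintro v w ⟨i, hi⟩ ⟨j, hj⟩
    have h1 := hg2 (v, i)
    have h2 := hg2 (w, j)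
    simp only [hi, hj] at h1 h2
    have : (v, i) = (w, j) := finj (by rw [h1, h2, Sym2.eq_swap])
    have hadj := hg1 (v, i)
    rw [hi] at hadj
    exact hadj.ne (Prod.ext_iff.1 this).1
  have hadj : ∀ v w, (∃ i, g (v, i) = w) → H.Adj v w := by
    rintro v w ⟨i, rfl⟩
    exact hg1 (v, i)
  have hout : ∀ v, m ≤ (Finset.univ.filter (fun w => ∃ i, g (v, i) = w)).card := by
    intro v
    have : (Finset.univ : Finset (Fin m)).card ≤
        (Finset.univ.filter (fun w => ∃ i, g (v, i) = w)).card := by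
      refine Finset.card_le_card_of_injOn (fun i => g (v, i)) ?_ ?_
      · intro i _
        simp
      · intro a _ b _ hab
        have : (v, a) = (v, b) := finj (by rw [hg2, hg2]; exact congrArg (fun x => s(v, x)) hab)
        exact (Prod.ext_iff.1 this).2
    simpa using this
  refine ⟨fun v w => ∃ i, g (v, i) = w, hadj, hasymm, fun v => by convert hout v, ?_⟩
  intro w
  have hdisj : Disjoint (Finset.univ.filter (fun v => ∃ i, g (v, i) = w))
      (Finset.univ.filter (fun v => ∃ i, g (w, i) = v)) := by
    rw [Finset.disjoint_filter]
    intro v _ h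
    exact hasymm v w h
  have hsub : (Finset.univ.filter (fun v => ∃ i, g (v, i) = w)) ∪
      (Finset.univ.filter (fun v => ∃ i, g (w, i) = v)) ⊆
      Finset.univ.filter (fun v => H.Adj w v) := by
    intro v hv
    simp only [Finset.mem_union, Finset.mem_filter, Finset.mem_univ, true_and] at hv ⊢
    rcases hv with h | h
    · exact (hadj v w h).symm
    · exact hadj w v h
  have h1 := Finset.card_le_card hsub
  rw [Finset.card_union_of_disjoint hdisj, hreg w] at h1
  have h2 := hout w
  have h3 : (Finset.univ.filter (fun v => ∃ i, g (v, i) = w)).card ≤ m := by omega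
  convert h3

lemma isPerm_aux {n : ℕ} (σ : Equiv.Perm (Fin n)) :
    IsPermMatrix (Matrix.of fun i j => if σ i = j then (1 : ℝ) else 0) := by
  refine ⟨?_, ?_, ?_⟩
  · intro i j
    by_cases h : σ i = j <;> simp [h]
  · intro i
    simp
  · intro j
    simp only [Matrix.of_apply]
    rw [Finset.sum_eq_single (σ.symm j)]
    · simp
    · intro b _ hb
      rw [if_neg]
      rintro rfl
      simp at hb
    · simp

/-- For odd `N` and `2 ≤ K ≤ N-3` with `N·K` even, given a `K`-regular
graph with adjacency matrix `A_K`, there is a `(K+2)`-regular graph on `N` vertices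
whose adjacency matrix is `P₃ (A_K + P₄ + P₅)` for permutation matrices `P₃, P₄, P₅`. -/
theorem stmt_9 (N K : ℕ) (hN : Odd N) (hK : 2 ≤ K) (hKN : K ≤ N - 3)
    (hNK : Even (N * K))
    (G : SimpleGraph (Fin N)) (hreg : G.IsRegularOfDegree K) :
    ∃ (G' : SimpleGraph (Fin N)) (P₃ P₄ P₅ : Matrix (Fin N) (Fin N) ℝ),
      G'.IsRegularOfDegree (K + 2) ∧ IsPermMatrix P₃ ∧ IsPermMatrix P₄ ∧ IsPermMatrix P₅ ∧
      G'.adjMatrix ℝ = P₃ * (G.adjMatrix ℝ + P₄ + P₅) := by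
  have hKe : Even K := by
    rcases Nat.even_mul.1 hNK with h | h
    · exact absurd hN (Nat.not_odd_iff_even.2 h)
    · exact h
  obtain ⟨m, hm⟩ : ∃ m, N - 1 - K = 2 * m := by
    obtain ⟨a, rfl⟩ := hN
    obtain ⟨b, rfl⟩ := hKe
    exact ⟨a - b, by omega⟩
  have hcard : ∀ v, (Finset.univ.filter (fun w => G.Adj v w)).card = K := by
    intro v
    rw [← hreg v, ← SimpleGraph.card_neighborFinset_eq_degree]
    congr 1
    ext w
    simp
  have hcompl : ∀ v, (Finset.univ.filter (fun w => Gᶜ.Adj v w)).card = 2 * m := by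
    intro v
    have h1 : Finset.univ.filter (fun w => Gᶜ.Adj v w) =
        (insert v (Finset.univ.filter (fun w => G.Adj v w)))ᶜ := by
      ext w
      simp [SimpleGraph.compl_adj, eq_comm]
    rw [h1, Finset.card_compl, Finset.card_insert_of_notMem (by simp), hcard, Fintype.card_fin]
    omega
  obtain ⟨D, hD1, hD2, hD3, hD4⟩ := orient_aux Gᶜ m (by omega) (fun v => by convert hcompl v)
  obtain ⟨f, finj, hf⟩ := hall_aux D m (by omega) hD3 hD4
  let σ : Equiv.Perm (Fin N) := Equiv.ofBijective f (Finite.injective_iff_bijective.1 finj)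
  have hσ : ∀ v, D v (σ v) := hf
  have hσ1 : ∀ v, v ≠ σ v := fun v => (hD1 _ _ (hσ v)).ne
  have hσ2 : ∀ v, ¬ G.Adj v (σ v) := fun v => ((SimpleGraph.compl_adj _ _ _).1 (hD1 _ _ (hσ v))).2
  have hσ3 : ∀ v w, σ v = w → σ w ≠ v := by
    rintro v w rfl h
    have h1 := hσ (σ v)
    rw [h] at h1
    exact hD2 _ _ (hσ v) h1
  let G' : SimpleGraph (Fin N) :=
    { Adj := fun v w => G.Adj v w ∨ σ v = w ∨ σ w = v
      symm := ⟨by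
        rintro v w (h | h | h)
        · exact Or.inl h.symm
        · exact Or.inr (Or.inr h)
        · exact Or.inr (Or.inl h)⟩
      loopless := ⟨by
        rintro v (h | h | h)
        · exact G.loopless.irrefl v h
        · exact hσ1 v h.symm
        · exact hσ1 v h.symm⟩ }
  have hG' : ∀ v w, G'.Adj v w ↔ G.Adj v w ∨ σ v = w ∨ σ w = v := fun _ _ => Iff.rfl
  refine ⟨G', 1, Matrix.of fun i j => if σ i = j then (1 : ℝ) else 0,
    Matrix.of fun i j => if σ.symm i = j then (1 : ℝ) else 0, ?_, ?_,
    isPerm_aux σ, isPerm_aux σ.symm, ?_⟩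
  · intro v
    rw [← SimpleGraph.card_neighborFinset_eq_degree]
    have h1 : G'.neighborFinset v = (insert (σ v) (insert (σ.symm v)
        (Finset.univ.filter (fun w => G.Adj v w)))) := by
      ext w
      simp only [SimpleGraph.mem_neighborFinset, hG', Finset.mem_insert, Finset.mem_filter,
        Finset.mem_univ, true_and, Equiv.eq_symm_apply, eq_comm (a := w) (b := σ v)]
      tauto
    have h2 : (G'.neighborFinset v).card = _ := congrArg Finset.card h1
    refine Eq.trans (by congr!) (h2.trans ?_)
    rw [Finset.card_insert_of_notMem, Finset.card_insert_of_notMem, hcard]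
    · simp only [Finset.mem_filter, Finset.mem_univ, true_and]
      intro h
      have := hσ2 (σ.symm v)
      rw [Equiv.apply_symm_apply] at this
      exact this h.symm
    · simp only [Finset.mem_insert, Finset.mem_filter, Finset.mem_univ, true_and, not_or,
        Equiv.eq_symm_apply]
      exact ⟨hσ3 v _ rfl, hσ2 v⟩
  · have := isPerm_aux (1 : Equiv.Perm (Fin N))
    convert this using 1
    ext i j
    by_cases h : i = j <;> simp [Matrix.one_apply, h]
  · rw [one_mul]
    ext i j
    simp only [SimpleGraph.adjMatrix_apply, Matrix.add_apply, Matrix.of_apply, hG',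
      Equiv.symm_apply_eq]
    by_cases h1 : G.Adj i j
    · have h2 : σ i ≠ j := by
        rintro rfl
        exact hσ2 _ h1
      have h3 : i ≠ σ j := by
        rintro rfl
        exact hσ2 _ h1.symm
      simp [h1, h2, h3]
    · by_cases h2 : σ i = j
      · have h3 : i ≠ σ j := (hσ3 i j h2).symm
        simp [h1, h2, h3]
      · simp [h1, h2, eq_comm]
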